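/- For every ε > 0 and every positive integer L there is a positive integer M (with M ≥ L) such that for all m, n ≥ M, every nonzero real m × n matrix A has an (ε)-regular block partition (𝒫,𝒬) with exceptional sets (V₀,W₀) such that L ≤ |𝒫| ≤ M and L ≤ |𝒬| ≤ M. -/

import Mathlib

open Finset

/-- `w_A(X,Y)`: the sum of the entries of `A` over the block `X × Y`. -/
def wSum {V W : Type*} (A : V → W → ℝ) (X : Finset V) (Y : Finset W) : ℝ :=
  ∑ x ∈ X, ∑ y ∈ Y, A x y

/-- `d_A(X,Y)`: the density of the block `X × Y`. -/
noncomputable def dens {V W : Type*} (A : V → W → ℝ) (X : Finset V) (Y : Finset W) : ℝ :=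
  wSum A X Y / ((X.card : ℝ) * (Y.card : ℝ))

/-- `‖A‖`: the sum of the absolute values of the entries of `A`. -/
def matNorm {V W : Type*} [Fintype V] [Fintype W] (A : V → W → ℝ) : ℝ :=
  ∑ x : V, ∑ y : W, |A x y|

/-- The normalized matrix `A* = (|V||W|/‖A‖) · A`. -/
noncomputable def normalizeMat {V W : Type*} [Fintype V] [Fintype W] (A : V → W → ℝ) :
    V → W → ℝ :=
  fun x y => ((Fintype.card V : ℝ) * (Fintype.card W : ℝ) / matNorm A) * A x y

/-- The submatrix `(X, Y)` of `A` is `ε`-regular. -/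
def EpsRegular {V W : Type*} (A : V → W → ℝ) (ε : ℝ) (X : Finset V) (Y : Finset W) : Prop :=
  ∀ X' ⊆ X, ∀ Y' ⊆ Y, ε * X.card ≤ X'.card → ε * Y.card ≤ Y'.card →
    |dens A X' Y' - dens A X Y| ≤ ε

/-- A partition of `V` with an exceptional set and `k` non-exceptional classes is encoded
as a map `p : V → Fin (k+1)`; class `0` is the exceptional set, and `classOf p i` is the
`i`-th class. -/
def classOf {V : Type*} [Fintype V] {k : ℕ} (p : V → Fin (k + 1)) (i : Fin (k + 1)) :
    Finset V :=
  Finset.univ.filter fun x => p x = i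

/-- The partition encoded by `p` (with exceptional class `0`) is balanced: all
non-exceptional classes have equal size. -/
def BalancedP {V : Type*} [Fintype V] {k : ℕ} (p : V → Fin (k + 1)) : Prop :=
  ∀ i j : Fin (k + 1), i ≠ 0 → j ≠ 0 → (classOf p i).card = (classOf p j).card

open Classical in
/-- `(p, q)` is an `ε`-regular block partition of `A` with exceptional sets the classes `0`:
it is balanced, the exceptional sets have size `< ε|V|`, `< ε|W|`, and all but at most
`ε·k·l` of the non-exceptional blocks are `ε`-regular. -/
def EpsRegularPartition {V W : Type*} [Fintype V] [Fintype W] {k l : ℕ}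
    (A : V → W → ℝ) (ε : ℝ) (p : V → Fin (k + 1)) (q : W → Fin (l + 1)) : Prop :=
  BalancedP p ∧ BalancedP q ∧
  ((classOf p 0).card : ℝ) < ε * Fintype.card V ∧
  ((classOf q 0).card : ℝ) < ε * Fintype.card W ∧
  ((((Finset.univ : Finset (Fin (k + 1) × Fin (l + 1))).filter fun ij =>
      ij.1 ≠ 0 ∧ ij.2 ≠ 0 ∧ ¬ EpsRegular A ε (classOf p ij.1) (classOf q ij.2)).card : ℝ)
    ≤ ε * k * l)

/-- `(p, q)` is an `(ε)`-regular block partition of `A`: an `ε`-regular block partition of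
the normalized matrix `A*`. -/
noncomputable def ScaledEpsRegularPartition {V W : Type*} [Fintype V] [Fintype W] {k l : ℕ}
    (A : V → W → ℝ) (ε : ℝ) (p : V → Fin (k + 1)) (q : W → Fin (l + 1)) : Prop :=
  EpsRegularPartition (normalizeMat A) ε p q

/-- Greedily cut the complement of `E` into monochromatic chunks of size `s`. -/
theorem exists_equal_chunks {V α : Type*} [Fintype V] [DecidableEq V] [Fintype α]
    [DecidableEq α] (f : V → α) {s : ℕ} (hs : 0 < s) (E : Finset V) :
    ∃ (k : ℕ) (p : V → Fin (k + 1)), (∀ i, i ≠ 0 → #(classOf p i) = s) ∧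
      (∀ x x', p x = p x' → p x ≠ 0 → f x = f x') ∧ (∀ x ∈ E, p x = 0) ∧
      #(classOf p 0) ≤ #E + Fintype.card α * s := by
  induction h : #Eᶜ using Nat.strong_induction_on generalizing E with
  | _ N ih =>
  by_cases hbig : ∃ a, s ≤ #(Eᶜ.filter fun x => f x = a)
  · obtain ⟨a, ha⟩ := hbig
    obtain ⟨T, hT, hTs⟩ := exists_subset_card_eq ha
    have hTE : Disjoint E T := by
      rw [Finset.disjoint_left]
      intro x hx hxT
      have := hT hxT
      simp_all
    have hTa : ∀ x ∈ T, f x = a := fun x hx => (mem_filter.1 (hT hx)).2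
    have hcard : #(E ∪ T)ᶜ < N := by
      have h1 := card_union_of_disjoint hTE
      have h2 := card_compl (E ∪ T)
      have h3 := card_compl E
      have h4 := card_le_univ (E ∪ T)
      omega
    obtain ⟨k, p, hp, hmono, hE, h0⟩ := ih _ hcard (E ∪ T) rfl
    have hpT : ∀ x ∈ T, p x = 0 := fun x hx => hE x (mem_union_right _ hx)
    let p' : V → Fin (k + 1 + 1) := fun x => if x ∈ T then Fin.last _ else (p x).castSucc
    have hlast : classOf p' (Fin.last _) = T := by
      ext x
      by_cases hx : x ∈ T <;> simp [classOf, p', hx, Fin.castSucc_ne_last]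
    have hcast : ∀ i : Fin (k + 1), classOf p' i.castSucc = classOf p i \ T := by
      intro i
      ext x
      by_cases hx : x ∈ T <;> simp [classOf, p', hx, (Fin.castSucc_ne_last _).symm]
    refine ⟨k + 1, p', ?_, ?_, ?_, ?_⟩
    · intro i
      refine Fin.lastCases ?_ (fun j => ?_) i
      · intro _
        rw [hlast, hTs]
      · intro hj
        have hj' : j ≠ 0 := by
          rintro rfl
          exact hj rfl
        rw [hcast, sdiff_eq_self_of_disjoint, hp j hj']
        rw [Finset.disjoint_left]
        intro x hx hxT
        simp only [classOf, mem_filter, mem_univ, true_and] at hx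
        exact hj' (hx.symm.trans (hpT x hxT))
    · intro x x' hxx hx0
      by_cases hx : x ∈ T <;> by_cases hx' : x' ∈ T
      · rw [hTa x hx, hTa x' hx']
      · simp [p', hx, hx', (Fin.castSucc_ne_last _).symm] at hxx
      · simp [p', hx, hx', Fin.castSucc_ne_last] at hxx
      · simp only [p', hx, hx', if_false] at hxx hx0
        exact hmono x x' (Fin.castSucc_injective _ hxx) (fun h => hx0 (by rw [h]; rfl))
    · intro x hx
      have hxT : x ∉ T := Finset.disjoint_left.1 hTE hx
      simp [p', hxT, hE x (mem_union_left _ hx)]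
    · have h1 : classOf p' 0 = classOf p 0 \ T := hcast 0
      have h2 : T ⊆ classOf p 0 := fun x hx => by simp [classOf, hpT x hx]
      rw [h1, card_sdiff_of_subset h2]
      have := card_union_of_disjoint hTE
      omega
  · push Not at hbig
    refine ⟨0, fun _ => 0, fun i hi => absurd (Fin.fin_one_eq_zero i) hi,
      fun x x' _ h => absurd rfl h, fun _ _ => rfl, ?_⟩
    have h1 : #Eᶜ ≤ Fintype.card α * s := by
      rw [card_eq_sum_card_fiberwise (f := f) (t := univ) (fun _ _ => by simp)]
      refine (sum_le_card_nsmul _ _ s fun a _ => (hbig a).le).trans ?_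
      simp
    have h2 := card_add_card_compl E
    have h3 := card_le_univ (classOf (fun _ : V => (0 : Fin (0 + 1))) 0)
    omega

theorem sum_sum_classOf {V W : Type*} [Fintype V] [Fintype W] {k l : ℕ} (p : V → Fin (k + 1))
    (q : W → Fin (l + 1)) (u : V → W → ℝ) :
    ∑ ij : Fin (k + 1) × Fin (l + 1), ∑ x ∈ classOf p ij.1, ∑ y ∈ classOf q ij.2, u x y =
      ∑ x, ∑ y, u x y := by
  rw [Fintype.sum_prod_type, ← sum_fiberwise univ p (fun x => ∑ y, u x y)]
  refine sum_congr rfl fun i _ => ?_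
  change ∑ j, ∑ x ∈ classOf p i, ∑ y ∈ classOf q j, u x y = _
  rw [sum_comm]
  exact sum_congr rfl fun x _ => sum_fiberwise univ q (u x)

theorem card_classOf_zero_add {V : Type*} [Fintype V] {k s : ℕ} {p : V → Fin (k + 1)}
    (hp : ∀ i, i ≠ 0 → #(classOf p i) = s) :
    #(classOf p 0) + k * s = Fintype.card V := by
  have h : Fintype.card V = ∑ i, #(classOf p i) :=
    card_eq_sum_card_fiberwise (f := p) (t := univ) (fun _ _ => by simp)
  rw [h, Fin.sum_univ_succ, sum_congr rfl fun (i : Fin k) _ => hp i.succ (Fin.succ_ne_zero i)]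
  simp

/-- A balanced partition with boundedly many classes that respects a given colouring outside a
small exceptional set. -/
theorem exists_balanced_refinement {V α : Type*} [Fintype V] [DecidableEq V] [Fintype α]
    [DecidableEq α] (f : V → α) (E : Finset V) {N r : ℕ} (hα : Fintype.card α ≤ N) (hN : 0 < N)
    (hr : 0 < r) (hV : N * r ≤ Fintype.card V) {e : ℝ} (hE : (#E : ℝ) ≤ e * Fintype.card V)
    (he : e + 1 / r ≤ 1 / 2) :
    ∃ (k : ℕ) (p : V → Fin (k + 1)), N * r ≤ 2 * k ∧ k ≤ 2 * (N * r) ∧ BalancedP p ∧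
      (#(classOf p 0) : ℝ) ≤ (e + 1 / r) * Fintype.card V ∧
      (∀ x x', p x = p x' → p x ≠ 0 → f x = f x') ∧ (∀ x ∈ E, p x = 0) := by
  set m := Fintype.card V
  have hNr : 0 < N * r := Nat.mul_pos hN hr
  set s := m / (N * r)
  have hs0 : 0 < s := Nat.div_pos hV hNr
  obtain ⟨k, p, hp, hmono, hpE, h0⟩ := exists_equal_chunks f hs0 E
  have hsm : s * (N * r) ≤ m := Nat.div_mul_le_self _ _
  have hms : m < (s + 1) * (N * r) := by
    have := Nat.lt_div_mul_add (a := m) hNr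
    rw [add_mul, one_mul]; exact this
  have hsum := card_classOf_zero_add hp
  have hr' : (0 : ℝ) < r := by exact_mod_cast hr
  have h0' : (#(classOf p 0) : ℝ) ≤ (e + 1 / r) * m := by
    have h1 : (#(classOf p 0) : ℝ) ≤ #E + N * s := by
      exact_mod_cast h0.trans (by gcongr)
    have h2 : (N * s : ℝ) ≤ 1 / r * m := by
      rw [div_mul_eq_mul_div, le_div_iff₀ hr', one_mul]
      calc (N * s * r : ℝ) = s * (N * r) := by ring
        _ ≤ m := by exact_mod_cast hsm
    linarith
  refine ⟨k, p, ?_, ?_, fun i j hi hj => (hp i hi).trans (hp j hj).symm, h0', hmono, hpE⟩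
  · have h1 : (#(classOf p 0) : ℝ) ≤ 1 / 2 * m := h0'.trans (by gcongr)
    have h2 : 2 * #(classOf p 0) ≤ m := by
      have : (2 * #(classOf p 0) : ℝ) ≤ m := by linarith
      exact_mod_cast this
    have h3 : s * (N * r) ≤ s * (2 * k) := by
      have : s * (2 * k) = 2 * (k * s) := by ring
      omega
    exact Nat.le_of_mul_le_mul_left h3 hs0
  · have h1 : k * s ≤ m := by omega
    have h2 : (s + 1) * (N * r) ≤ 2 * s * (N * r) := Nat.mul_le_mul_right _ (by omega)
    have h3 : s * k ≤ s * (2 * (N * r)) := by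
      have e1 : s * k = k * s := mul_comm _ _
      have e2 : s * (2 * (N * r)) = 2 * s * (N * r) := by ring
      omega
    exact Nat.le_of_mul_le_mul_left h3 hs0
/-- The part of `x` in the partition encoded by `p`, with the exceptional class split into
singletons. -/
def cell {V : Type*} [Fintype V] [DecidableEq V] {k : ℕ} (p : V → Fin (k + 1)) (x : V) :
    Finset V :=
  if p x = 0 then {x} else classOf p (p x)

section Cell

variable {V : Type*} [Fintype V] [DecidableEq V] {k : ℕ} {p : V → Fin (k + 1)}

theorem mem_cell_iff {x x' : V} : x' ∈ cell p x ↔ x' = x ∨ (p x' = p x ∧ p x ≠ 0) := by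
  by_cases h : p x = 0
  · simp [cell, h]
  · simp only [cell, h, if_false, classOf, mem_filter, mem_univ, true_and, ne_eq, not_false_eq_true,
      and_true]
    exact ⟨Or.inr, fun h => h.elim (fun h => h ▸ rfl) id⟩

theorem mem_cell_comm {x x' : V} : x' ∈ cell p x ↔ x ∈ cell p x' := by
  rw [mem_cell_iff, mem_cell_iff]
  constructor <;>
  · rintro (h | ⟨h, h'⟩)
    · exact Or.inl h.symm
    · exact Or.inr ⟨h.symm, h ▸ h'⟩

theorem cell_eq_of_mem {x x' : V} (h : x' ∈ cell p x) : cell p x' = cell p x := by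
  rcases mem_cell_iff.1 h with rfl | ⟨h, h'⟩
  · rfl
  · simp [cell, h, h']

theorem card_cell_pos (x : V) : 0 < #(cell p x) :=
  card_pos.2 ⟨x, mem_cell_iff.2 (Or.inl rfl)⟩

/-- Averaging over cells does not change the pairing with a function constant on cells. -/
theorem sum_mul_cell_average (f g : V → ℝ)
    (hg : ∀ x x', p x = p x' → p x ≠ 0 → g x = g x') :
    ∑ x, g x * ((∑ x' ∈ cell p x, f x') / #(cell p x)) = ∑ x, g x * f x := by
  have hg' : ∀ x x', x' ∈ cell p x → g x = g x' := by
    intro x x' h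
    rcases mem_cell_iff.1 h with rfl | ⟨h, h'⟩
    · rfl
    · exact hg x x' h.symm h'
  calc ∑ x, g x * ((∑ x' ∈ cell p x, f x') / #(cell p x))
      = ∑ x, ∑ x' ∈ cell p x, g x' * f x' / #(cell p x') := by
        refine sum_congr rfl fun x _ => ?_
        rw [sum_div, mul_sum]
        refine sum_congr rfl fun x' hx' => ?_
        rw [cell_eq_of_mem hx', hg' x x' hx', mul_div_assoc]
    _ = ∑ x', ∑ x ∈ cell p x', g x' * f x' / #(cell p x') :=
        sum_comm' fun x x' => by simp [mem_cell_comm]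
    _ = ∑ x', g x' * f x' := by
        refine sum_congr rfl fun x _ => ?_
        have : (#(cell p x) : ℝ) ≠ 0 := by exact_mod_cast (card_cell_pos x).ne'
        rw [sum_const, nsmul_eq_mul]
        field_simp

end Cell

/-- `c` is constant on the blocks of `(p, q)`, the exceptional classes being split into
singletons. -/
def BlockConst {V W : Type*} {k l : ℕ} (p : V → Fin (k + 1)) (q : W → Fin (l + 1))
    (c : V → W → ℝ) : Prop :=
  (∀ x x' y, p x = p x' → p x ≠ 0 → c x y = c x' y) ∧
    ∀ x y y', q y = q y' → q y ≠ 0 → c x y = c x y'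

/-- The functional `∑ (2 c A - c²)`, whose maximum over block-constant `c` with `|c| ≤ D` is the
energy of a block partition. -/
def energy {V W : Type*} [Fintype V] [Fintype W] (A c : V → W → ℝ) : ℝ :=
  ∑ x, ∑ y, (2 * (c x y * A x y) - c x y ^ 2)

theorem energy_le {V W : Type*} [Fintype V] [Fintype W] {A c : V → W → ℝ} {D : ℝ}
    (hc : ∀ x y, |c x y| ≤ D) : energy A c ≤ 2 * D * matNorm A := by
  simp only [energy, matNorm, mul_sum]
  refine sum_le_sum fun x _ => sum_le_sum fun y _ => ?_
  have h1 : c x y * A x y ≤ D * |A x y| := by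
    calc c x y * A x y ≤ |c x y * A x y| := le_abs_self _
      _ = |c x y| * |A x y| := abs_mul _ _
      _ ≤ D * |A x y| := by gcongr; exact hc x y
  nlinarith [sq_nonneg (c x y)]

/-- Truncation of the block densities to `[-D, D]`. -/
noncomputable def truncDens {V W : Type*} [Fintype V] [Fintype W] [DecidableEq V] [DecidableEq W]
    {k l : ℕ} (A : V → W → ℝ) (D : ℝ) (p : V → Fin (k + 1)) (q : W → Fin (l + 1))
    (x : V) (y : W) : ℝ :=
  max (-D) (min D (dens A (cell p x) (cell q y)))

section TruncDens

variable {V W : Type*} [Fintype V] [Fintype W] [DecidableEq V] [DecidableEq W]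
    {k l : ℕ} {A : V → W → ℝ} {D : ℝ} {p : V → Fin (k + 1)} {q : W → Fin (l + 1)}

theorem abs_truncDens_le (hD : 0 ≤ D) (x : V) (y : W) : |truncDens A D p q x y| ≤ D :=
  abs_le.2 ⟨le_max_left _ _, max_le (by linarith) (min_le_left _ _)⟩

theorem blockConst_truncDens : BlockConst p q (truncDens A D p q) := by
  constructor
  · intro x x' y h h0
    rw [truncDens, truncDens, cell_eq_of_mem (mem_cell_iff.2 (Or.inr ⟨h, h ▸ h0⟩))]
  · intro x y y' h h0
    rw [truncDens, truncDens, cell_eq_of_mem (mem_cell_iff.2 (Or.inr ⟨h, h ▸ h0⟩))]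

theorem truncDens_eq {x : V} {y : W} (hx : p x ≠ 0) (hy : q y ≠ 0)
    (h : |dens A (classOf p (p x)) (classOf q (q y))| ≤ D) :
    truncDens A D p q x y = dens A (classOf p (p x)) (classOf q (q y)) := by
  rw [abs_le] at h
  simp [truncDens, cell, hx, hy, h.1, h.2]

theorem sum_mul_dens_cell {c : V → W → ℝ} (hc : BlockConst p q c) :
    ∑ x, ∑ y, c x y * dens A (cell p x) (cell q y) = ∑ x, ∑ y, c x y * A x y := by
  calc ∑ x, ∑ y, c x y * dens A (cell p x) (cell q y)
      = ∑ y, ∑ x, c x y * ((∑ x' ∈ cell p x, (∑ y' ∈ cell q y, A x' y') / #(cell q y)) /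
          #(cell p x)) := by
        rw [sum_comm]
        refine sum_congr rfl fun y _ => sum_congr rfl fun x _ => ?_
        rw [_root_.dens, wSum, ← sum_div, div_div, mul_comm (#(cell q y) : ℝ)]
    _ = ∑ x, ∑ y, c x y * ((∑ y' ∈ cell q y, A x y') / #(cell q y)) := by
        conv_rhs => rw [sum_comm]
        refine sum_congr rfl fun y _ => ?_
        exact sum_mul_cell_average _ (fun x => c x y) fun x x' => hc.1 x x' y
    _ = ∑ x, ∑ y, c x y * A x y :=
        sum_congr rfl fun x _ => sum_mul_cell_average _ (c x) (hc.2 x)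

theorem energy_eq_of_blockConst {c : V → W → ℝ} (hc : BlockConst p q c) :
    energy A c = ∑ x, ∑ y, (2 * (c x y * dens A (cell p x) (cell q y)) - c x y ^ 2) := by
  simp only [energy, sum_sub_distrib, ← mul_sum, sum_mul_dens_cell hc]

theorem energy_le_energy_truncDens {c : V → W → ℝ} (hc : BlockConst p q c)
    (hcD : ∀ x y, |c x y| ≤ D) : energy A c ≤ energy A (truncDens A D p q) := by
  rw [energy_eq_of_blockConst hc, energy_eq_of_blockConst blockConst_truncDens]
  refine sum_le_sum fun x _ => sum_le_sum fun y _ => ?_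
  have h := abs_le.1 (hcD x y)
  simp only [truncDens]
  set a := dens A (cell p x) (cell q y)
  set b := c x y
  rcases le_total D a with h1 | h1
  · rw [min_eq_left h1, max_eq_right (by linarith)]
    nlinarith
  · rw [min_eq_right h1]
    rcases le_total (-D) a with h2 | h2
    · rw [max_eq_right h2]
      nlinarith [sq_nonneg (a - b)]
    · rw [max_eq_left h2]
      nlinarith

end TruncDens

/-- Few blocks have large density. -/
theorem card_dense_blocks_mul_le {V W : Type*} [Fintype V] [Fintype W] {k l s t : ℕ}
    {p : V → Fin (k + 1)} {q : W → Fin (l + 1)} (hp : ∀ i, i ≠ 0 → #(classOf p i) = s)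
    (hq : ∀ j, j ≠ 0 → #(classOf q j) = t) (hs : 0 < s) (ht : 0 < t) {A : V → W → ℝ} {D : ℝ}
    {S : Finset (Fin (k + 1) × Fin (l + 1))}
    (hS : ∀ ij ∈ S, ij.1 ≠ 0 ∧ ij.2 ≠ 0 ∧ D ≤ |dens A (classOf p ij.1) (classOf q ij.2)|) :
    #S * (D * (s * t)) ≤ matNorm A := by
  rw [matNorm, ← sum_sum_classOf p q, ← nsmul_eq_mul]
  refine (card_nsmul_le_sum S (fun ij => ∑ x ∈ classOf p ij.1, ∑ y ∈ classOf q ij.2, |A x y|) _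
    fun ij hij => ?_).trans (sum_le_univ_sum_of_nonneg fun ij => by positivity)
  obtain ⟨hi, hj, hd⟩ := hS ij hij
  have hst : (0 : ℝ) < s * t := by positivity
  rw [_root_.dens, hp _ hi, hq _ hj, abs_div, abs_of_pos hst, le_div_iff₀ hst] at hd
  refine hd.trans ((abs_sum_le_sum_abs _ _).trans ?_)
  exact sum_le_sum fun x _ => abs_sum_le_sum_abs _ _

/-- Adding a suitable multiple of the indicator of a witness of irregularity inside each
irregular block of moderate density increases the energy. -/
theorem exists_energy_increment {V W : Type*} [Fintype V] [Fintype W] [DecidableEq V]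
    [DecidableEq W] {k l s t : ℕ} {p : V → Fin (k + 1)} {q : W → Fin (l + 1)} (hs : 0 < s)
    (ht : 0 < t) {A : V → W → ℝ} {D ε : ℝ} (hε : 0 < ε) (hεD : ε ≤ D / 2)
    {S : Finset (Fin (k + 1) × Fin (l + 1))}
    {X : Fin (k + 1) → Fin (l + 1) → Finset V} {Y : Fin (k + 1) → Fin (l + 1) → Finset W}
    (hS : ∀ i j, (i, j) ∈ S → i ≠ 0 ∧ j ≠ 0 ∧ |dens A (classOf p i) (classOf q j)| ≤ D / 2 ∧
      X i j ⊆ classOf p i ∧ Y i j ⊆ classOf q j ∧ ε * s ≤ #(X i j) ∧ ε * t ≤ #(Y i j) ∧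
      ε < |dens A (X i j) (Y i j) - dens A (classOf p i) (classOf q j)|) :
    ∃ τ : Fin (k + 1) → Fin (l + 1) → ℝ,
      (∀ x y, |truncDens A D p q x y +
        if x ∈ X (p x) (q y) ∧ y ∈ Y (p x) (q y) then τ (p x) (q y) else 0| ≤ D) ∧
      energy A (truncDens A D p q) + #S * (ε ^ 4 * (s * t)) ≤
        energy A fun x y => truncDens A D p q x y +
          if x ∈ X (p x) (q y) ∧ y ∈ Y (p x) (q y) then τ (p x) (q y) else 0 := by
  have hD : 0 ≤ D := by linarith
  have hex : ∀ i j, ∃ a : ℝ, ((i, j) ∉ S → a = 0) ∧ ((i, j) ∈ S → |a| = ε ∧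
      ε ^ 2 ≤ a * (dens A (X i j) (Y i j) - dens A (classOf p i) (classOf q j))) := by
    intro i j
    by_cases hij : (i, j) ∈ S
    · obtain ⟨-, -, -, -, -, -, -, h⟩ := hS i j hij
      rcases lt_abs.1 h with h | h
      · exact ⟨ε, fun h' => absurd hij h', fun _ => ⟨abs_of_pos hε, by nlinarith⟩⟩
      · exact ⟨-ε, fun h' => absurd hij h', fun _ => ⟨by rw [abs_neg, abs_of_pos hε],
          by nlinarith⟩⟩
    · exact ⟨0, fun _ => rfl, fun h => absurd h hij⟩
  choose τ hτ0 hτ using hex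
  refine ⟨τ, fun x y => ?_, ?_⟩
  · split_ifs with hxy
    · by_cases hij : (p x, q y) ∈ S
      · obtain ⟨hi, hj, hd, -⟩ := hS _ _ hij
        rw [truncDens_eq hi hj (by linarith)]
        refine (abs_add_le _ _).trans ?_
        rw [(hτ _ _ hij).1]
        linarith
      · rw [hτ0 _ _ hij, add_zero]
        exact abs_truncDens_le hD x y
    · rw [add_zero]
      exact abs_truncDens_le hD x y
  · rw [← le_sub_iff_add_le']
    simp only [energy, ← sum_sub_distrib]
    rw [← sum_sum_classOf p q]
    have hsum : (#S : ℝ) * (ε ^ 4 * (s * t)) =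
        ∑ ij : Fin (k + 1) × Fin (l + 1), if ij ∈ S then ε ^ 4 * (s * t) else 0 := by
      simp
    rw [hsum]
    refine sum_le_sum fun ⟨i, j⟩ _ => ?_
    by_cases hij : (i, j) ∈ S
    · obtain ⟨hi, hj, hd, hX, hY, hXs, hYt, -⟩ := hS i j hij
      obtain ⟨hτa, hτd⟩ := hτ i j hij
      set d := dens A (classOf p i) (classOf q j)
      have hXpos : (0 : ℝ) < #(X i j) := lt_of_lt_of_le (by positivity) hXs
      have hYpos : (0 : ℝ) < #(Y i j) := lt_of_lt_of_le (by positivity) hYt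
      have hblock : ∀ x ∈ classOf p i, ∀ y ∈ classOf q j,
          2 * ((truncDens A D p q x y +
            if x ∈ X (p x) (q y) ∧ y ∈ Y (p x) (q y) then τ (p x) (q y) else 0) * A x y) -
            (truncDens A D p q x y +
              if x ∈ X (p x) (q y) ∧ y ∈ Y (p x) (q y) then τ (p x) (q y) else 0) ^ 2 -
            (2 * (truncDens A D p q x y * A x y) - truncDens A D p q x y ^ 2) =
          if x ∈ X i j then if y ∈ Y i j then
            2 * τ i j * A x y - (2 * τ i j * d + τ i j ^ 2) else 0 else 0 := by
        intro x hx y hy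
        simp only [classOf, mem_filter, mem_univ, true_and] at hx hy
        subst hx hy
        rw [truncDens_eq hi hj (by linarith)]
        by_cases h1 : x ∈ X (p x) (q y) <;> by_cases h2 : y ∈ Y (p x) (q y) <;>
          simp only [h1, h2, if_true, if_false, and_self, and_true, and_false] <;> ring
      rw [sum_congr rfl fun x hx => sum_congr rfl fun y hy => hblock x hx y hy]
      have hinner : ∀ x, (∑ y ∈ classOf q j, if x ∈ X i j then if y ∈ Y i j then
            2 * τ i j * A x y - (2 * τ i j * d + τ i j ^ 2) else 0 else 0) =
          if x ∈ X i j then ∑ y ∈ Y i j, (2 * τ i j * A x y - (2 * τ i j * d + τ i j ^ 2))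
            else 0 := by
        intro x
        split_ifs
        · rw [← sum_filter, filter_mem_eq_inter, inter_eq_right.2 hY]
        · simp
      rw [sum_congr rfl fun x _ => hinner x, ← sum_filter, filter_mem_eq_inter,
        inter_eq_right.2 hX]
      simp only [sum_sub_distrib, ← mul_sum, sum_const, nsmul_eq_mul]
      have hw : ∑ x ∈ X i j, ∑ y ∈ Y i j, A x y =
          dens A (X i j) (Y i j) * (#(X i j) * #(Y i j)) := by
        rw [_root_.dens, wSum]
        field_simp
      rw [hw, if_pos hij]
      have hsq : τ i j ^ 2 = ε ^ 2 := by rw [← sq_abs, hτa]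
      rw [hsq]
      calc ε ^ 4 * (s * t) = ε ^ 2 * ((ε * s) * (ε * t)) := by ring
        _ ≤ ε ^ 2 * (#(X i j) * #(Y i j)) := by gcongr
        _ ≤ (2 * (τ i j * (dens A (X i j) (Y i j) - d)) - ε ^ 2) * (#(X i j) * #(Y i j)) := by
          gcongr
          linarith
        _ = _ := by ring
    · rw [if_neg hij]
      refine sum_nonneg fun x hx => sum_nonneg fun y hy => ?_
      simp only [classOf, mem_filter, mem_univ, true_and] at hx hy
      subst hx hy
      simp [hτ0 _ _ hij]

theorem EpsRegular.mono {V W : Type*} {A : V → W → ℝ} {ε ε' : ℝ} {X : Finset V} {Y : Finset W}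
    (h : EpsRegular A ε X Y) (hε : ε ≤ ε') : EpsRegular A ε' X Y := fun X' hX Y' hY hXc hYc =>
  (h X' hX Y' hY ((by gcongr : ε * #X ≤ ε' * #X).trans hXc)
    ((by gcongr : ε * #Y ≤ ε' * #Y).trans hYc)).trans hε

theorem EpsRegularPartition.mono {V W : Type*} [Fintype V] [Fintype W] {k l : ℕ}
    {A : V → W → ℝ} {ε ε' : ℝ} {p : V → Fin (k + 1)} {q : W → Fin (l + 1)}
    (h : EpsRegularPartition A ε p q) (hε : ε ≤ ε') : EpsRegularPartition A ε' p q := by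
  obtain ⟨h1, h2, h3, h4, h5⟩ := h
  refine ⟨h1, h2, h3.trans_le (by gcongr), h4.trans_le (by gcongr), ?_⟩
  refine le_trans (Nat.cast_le.2 (card_le_card fun ij => ?_)) (h5.trans (by gcongr))
  simp only [mem_filter, mem_univ, true_and]
  exact fun h => ⟨h.1, h.2.1, fun h' => h.2.2 (h'.mono hε)⟩

/-- There is a balanced block partition with between `L` and `K` classes on each side, exceptional
sets of proportion at most `e`, and energy at least `E`. -/
def HasEnergyPartition {V W : Type*} [Fintype V] [Fintype W] (A : V → W → ℝ) (L K : ℕ)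
    (D e E : ℝ) : Prop :=
  ∃ (k l : ℕ) (p : V → Fin (k + 1)) (q : W → Fin (l + 1)) (c : V → W → ℝ),
    L ≤ k ∧ k ≤ K ∧ L ≤ l ∧ l ≤ K ∧ BalancedP p ∧ BalancedP q ∧
    (#(classOf p 0) : ℝ) ≤ e * Fintype.card V ∧ (#(classOf q 0) : ℝ) ≤ e * Fintype.card W ∧
    BlockConst p q c ∧ (∀ x y, |c x y| ≤ D) ∧ E ≤ energy A c

theorem BalancedP.exists_card_eq {V : Type*} [Fintype V] [Nonempty V] {k : ℕ}
    {p : V → Fin (k + 1)} (hp : BalancedP p) (hk : 0 < k) {e : ℝ} (he : e ≤ 1 / 2)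
    (h0 : (#(classOf p 0) : ℝ) ≤ e * Fintype.card V) :
    ∃ s : ℕ, 0 < s ∧ (∀ i, i ≠ 0 → #(classOf p i) = s) ∧ (Fintype.card V : ℝ) ≤ 2 * (k * s) := by
  have hk1 : (⟨1, by omega⟩ : Fin (k + 1)) ≠ 0 := by simp [Fin.ext_iff]
  have hs : ∀ i, i ≠ 0 → #(classOf p i) = #(classOf p ⟨1, by omega⟩) :=
    fun i hi => hp _ _ hi hk1
  have hcard : (Fintype.card V : ℝ) ≤ 2 * (k * #(classOf p ⟨1, by omega⟩)) := by
    have h1 : (#(classOf p 0) : ℝ) + k * #(classOf p ⟨1, by omega⟩) = Fintype.card V := by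
      exact_mod_cast card_classOf_zero_add hs
    have h2 : e * Fintype.card V ≤ 1 / 2 * Fintype.card V := by gcongr
    linarith
  refine ⟨_, Nat.pos_of_ne_zero fun h => ?_, hs, hcard⟩
  have hV : (0 : ℝ) < Fintype.card V := by exact_mod_cast Fintype.card_pos
  rw [h] at hcard
  simp at hcard

/-- A block partition is either regular, or can be refined with an increase of energy. -/
theorem HasEnergyPartition.regular_or_increment {V W : Type*} [Fintype V] [Fintype W]
    [DecidableEq V] [DecidableEq W] [Nonempty V] [Nonempty W] {A : V → W → ℝ}
    (hA : matNorm A ≤ Fintype.card V * Fintype.card W) {L K r : ℕ} {ε e E : ℝ}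
    (hL : 0 < L) (hε : 0 < ε) (hε1 : ε ≤ 1) (hr : 2 ≤ r) (heε : e < ε)
    (he : e + 1 / r ≤ 1 / 2)
    (hV : (K + 1) * 2 ^ (K + 1) * r ≤ Fintype.card V)
    (hW : (K + 1) * 2 ^ (K + 1) * r ≤ Fintype.card W)
    (h : HasEnergyPartition A L K (16 / ε) e E) :
    (∃ (k l : ℕ) (p : V → Fin (k + 1)) (q : W → Fin (l + 1)),
      L ≤ k ∧ k ≤ K ∧ L ≤ l ∧ l ≤ K ∧ EpsRegularPartition A ε p q) ∨
    HasEnergyPartition A L (2 * ((K + 1) * 2 ^ (K + 1) * r)) (16 / ε) (e + 1 / r)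
      (E + ε ^ 5 / 8 * (Fintype.card V * Fintype.card W)) := by
  classical
  obtain ⟨k, l, p, q, c, hLk, hkK, hLl, hlK, hp, hq, hp0, hq0, hc, hcD, hcE⟩ := h
  have hVpos : (0 : ℝ) < Fintype.card V := by exact_mod_cast Fintype.card_pos
  have hWpos : (0 : ℝ) < Fintype.card W := by exact_mod_cast Fintype.card_pos
  have he' : e ≤ 1 / 2 := le_trans (by simp) he
  obtain ⟨s, hs, hps, hks⟩ := hp.exists_card_eq (by omega) he' hp0
  obtain ⟨t, ht, hqt, hlt⟩ := hq.exists_card_eq (by omega) he' hq0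
  by_cases hreg : EpsRegularPartition A ε p q
  · exact Or.inl ⟨k, l, p, q, hLk, hkK, hLl, hlK, hreg⟩
  right
  set S := (univ : Finset (Fin (k + 1) × Fin (l + 1))).filter fun ij =>
    ij.1 ≠ 0 ∧ ij.2 ≠ 0 ∧ ¬ EpsRegular A ε (classOf p ij.1) (classOf q ij.2) with hS
  have hScard : ε * k * l < #S := by
    by_contra! hle
    exact hreg ⟨hp, hq, hp0.trans_lt (by gcongr), hq0.trans_lt (by gcongr), hle⟩
  set R := S.filter fun ij => 16 / ε / 2 ≤ |dens A (classOf p ij.1) (classOf q ij.2)| with hR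
  have hcards : (Fintype.card V * Fintype.card W : ℝ) ≤ 4 * (k * l * (s * t)) :=
    calc (Fintype.card V * Fintype.card W : ℝ) ≤ (2 * (k * s)) * (2 * (l * t)) := by gcongr
      _ = _ := by ring
  have hst : (0 : ℝ) < s * t := by positivity
  have hRcard : (#R : ℝ) ≤ ε * k * l / 2 := by
    have h1 : #R * (16 / ε / 2 * (s * t)) ≤ matNorm A :=
      card_dense_blocks_mul_le hps hqt hs ht fun ij hij => by
        simp only [hR, hS, mem_filter, mem_univ, true_and] at hij
        exact ⟨hij.1.1, hij.1.2.1, hij.2⟩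
    have h2 : (#R * (16 / ε / 2)) * (s * t) ≤ (4 * (k * l)) * (s * t) := by linarith
    have h3 := le_of_mul_le_mul_right h2 hst
    have h4 : (#R : ℝ) * (16 / ε / 2) * (ε / 8) ≤ 4 * (k * l) * (ε / 8) := by gcongr
    have h5 : (#R : ℝ) * (16 / ε / 2) * (ε / 8) = #R := by field_simp; ring
    linarith
  set B := S \ R with hB
  have hBcard : ε * k * l / 2 ≤ #B := by
    have h1 : (#B : ℝ) + #R = #S := by
      exact_mod_cast card_sdiff_add_card_eq_card (filter_subset _ S)
    linarith
  have hex : ∀ i j, ∃ (X : Finset V) (Y : Finset W), (i, j) ∈ B →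
      i ≠ 0 ∧ j ≠ 0 ∧ |dens A (classOf p i) (classOf q j)| ≤ 16 / ε / 2 ∧
      X ⊆ classOf p i ∧ Y ⊆ classOf q j ∧ ε * s ≤ #X ∧ ε * t ≤ #Y ∧
      ε < |dens A X Y - dens A (classOf p i) (classOf q j)| := by
    intro i j
    by_cases hij : (i, j) ∈ B
    · simp only [hB, hR, hS, mem_sdiff, mem_filter, mem_univ, true_and, not_and, not_le] at hij
      obtain ⟨⟨hi, hj, hirr⟩, hd⟩ := hij
      have hd' := hd ⟨hi, hj, hirr⟩
      simp only [EpsRegular, not_forall, not_le] at hirr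
      obtain ⟨X, hX, Y, hY, hXc, hYc, hXY⟩ := hirr
      rw [hps i hi] at hXc
      rw [hqt j hj] at hYc
      exact ⟨X, Y, fun _ => ⟨hi, hj, hd'.le, hX, hY, hXc, hYc, hXY⟩⟩
    · exact ⟨∅, ∅, fun h => absurd h hij⟩
  choose X Y hXY using hex
  have hεD : ε ≤ 16 / ε / 2 := by
    rw [div_div, le_div_iff₀ (by positivity)]
    nlinarith
  obtain ⟨τ, hτD, hτE⟩ := exists_energy_increment hs ht hε hεD hXY
  have hN : 0 < (K + 1) * 2 ^ (K + 1) := by positivity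
  have hcardle : ∀ a b : ℕ, a ≤ K → b ≤ K →
      Fintype.card (Fin (a + 1) × (Fin (b + 1) → Bool)) ≤ (K + 1) * 2 ^ (K + 1) := by
    intro a b ha hb
    simp only [Fintype.card_prod, Fintype.card_fin, Fintype.card_fun, Fintype.card_bool]
    gcongr
    norm_num
  obtain ⟨k', p', hk'1, hk'2, hp'b, hp'0, hp'f, hp'E⟩ :=
    exists_balanced_refinement (fun x => (p x, fun j => decide (x ∈ X (p x) j))) (classOf p 0)
      (hcardle k l hkK hlK) hN (by omega) hV hp0 he
  obtain ⟨l', q', hl'1, hl'2, hq'b, hq'0, hq'f, hq'E⟩ :=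
    exists_balanced_refinement (fun y => (q y, fun i => decide (y ∈ Y i (q y)))) (classOf q 0)
      (hcardle l k hlK hkK) hN (by omega) hW hq0 he
  have hLN : 2 * L ≤ (K + 1) * 2 ^ (K + 1) * r := by
    have h1 : L ≤ (K + 1) * 2 ^ (K + 1) :=
      (by omega : L ≤ (K + 1) * 1).trans (Nat.mul_le_mul_left _ Nat.one_le_two_pow)
    nlinarith
  refine ⟨k', l', p', q', _, by omega, hk'2, by omega, hl'2, hp'b, hq'b, hp'0, hq'0, ?_, hτD, ?_⟩
  · constructor
    · intro x x' y hx hx0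
      have hf := hp'f x x' hx hx0
      simp only [Prod.mk.injEq] at hf
      have hpx0 : p x ≠ 0 := fun h => hx0 (hp'E x (by simp [classOf, h]))
      have hmem : x ∈ X (p x) (q y) ↔ x' ∈ X (p x) (q y) := by
        have := congrFun hf.2 (q y)
        rw [decide_eq_decide, ← hf.1] at this
        exact this
      simp only [blockConst_truncDens.1 x x' y hf.1 hpx0, hmem, ← hf.1]
    · intro x y y' hy hy0
      have hf := hq'f y y' hy hy0
      simp only [Prod.mk.injEq] at hf
      have hqy0 : q y ≠ 0 := fun h => hy0 (hq'E y (by simp [classOf, h]))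
      have hmem : y ∈ Y (p x) (q y) ↔ y' ∈ Y (p x) (q y) := by
        have := congrFun hf.2 (p x)
        rw [decide_eq_decide, ← hf.1] at this
        exact this
      simp only [blockConst_truncDens.2 x y y' hf.1 hqy0, hmem, ← hf.1]
  · refine le_trans ?_ hτE
    have h1 := energy_le_energy_truncDens (A := A) hc hcD
    have h2 : ε ^ 5 / 8 * (Fintype.card V * Fintype.card W) ≤ #B * (ε ^ 4 * (s * t)) :=
      calc ε ^ 5 / 8 * (Fintype.card V * Fintype.card W)
          ≤ ε ^ 5 / 8 * (4 * (k * l * (s * t))) := by gcongr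
        _ = ε * k * l / 2 * (ε ^ 4 * (s * t)) := by ring
        _ ≤ #B * (ε ^ 4 * (s * t)) := by gcongr
    linarith

theorem matNorm_normalizeMat_le {V W : Type*} [Fintype V] [Fintype W] (A : V → W → ℝ) :
    matNorm (normalizeMat A) ≤ Fintype.card V * Fintype.card W := by
  have h0 : 0 ≤ matNorm A := sum_nonneg fun x _ => sum_nonneg fun y _ => abs_nonneg _
  have h : matNorm (normalizeMat A) =
      (Fintype.card V : ℝ) * Fintype.card W / matNorm A * matNorm A := by
    conv_lhs => rw [matNorm]
    simp only [normalizeMat, abs_mul, ← mul_sum]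
    rw [abs_of_nonneg (by positivity), ← matNorm]
  rw [h]
  rcases h0.eq_or_lt with h0 | h0
  · rw [← h0, mul_zero]
    positivity
  · rw [div_mul_cancel₀ _ h0.ne']

/-- Iterating the energy increment `T` times either produces a regular partition or accumulates
energy proportional to `T`. -/
theorem exists_regular_or_hasEnergyPartition {ε : ℝ} (hε : 0 < ε) (hε1 : ε ≤ 1 / 2) {L r : ℕ}
    (hL : 0 < L) (hr : 2 ≤ r) (T : ℕ) (hT : (T + 2) / r < ε) :
    ∃ K : ℕ, L ≤ K ∧ ∀ m n : ℕ, K ≤ m → K ≤ n → ∀ A : Fin m → Fin n → ℝ,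
      matNorm A ≤ m * n →
      (∃ (k l : ℕ) (p : Fin m → Fin (k + 1)) (q : Fin n → Fin (l + 1)),
        L ≤ k ∧ k ≤ K ∧ L ≤ l ∧ l ≤ K ∧ EpsRegularPartition A ε p q) ∨
      HasEnergyPartition A L K (16 / ε) ((T + 1) / r) (T * (ε ^ 5 / 8 * (m * n))) := by
  have hr0 : (0 : ℝ) < r := by positivity
  induction T with
  | zero =>
    refine ⟨2 * (L * r), by nlinarith, fun m n hm hn A hA => Or.inr ?_⟩
    have he : (0 : ℝ) + 1 / r ≤ 1 / 2 := by
      have : (1 : ℝ) / r ≤ ((0 : ℕ) + 2) / r := by gcongr; norm_num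
      linarith
    have hsplit : ∀ N : ℕ, 2 * (L * r) ≤ N → ∃ (k : ℕ) (p : Fin N → Fin (k + 1)), L ≤ k ∧
        k ≤ 2 * (L * r) ∧ BalancedP p ∧ (#(classOf p 0) : ℝ) ≤ (1 / r) * N := by
      intro N hN
      obtain ⟨k, p, h1, h2, h3, h4, -, -⟩ := exists_balanced_refinement (V := Fin N)
        (fun _ => ()) ∅ (N := L) (r := r) (by rw [Fintype.card_unit]; exact hL)
        hL (by omega)
        (by rw [Fintype.card_fin]; omega) (e := 0) (by simp) he
      refine ⟨k, p, by nlinarith, h2, h3, ?_⟩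
      simpa using h4
    obtain ⟨k, p, h1, h2, h3, h4⟩ := hsplit m hm
    obtain ⟨l, q, h1', h2', h3', h4'⟩ := hsplit n hn
    refine ⟨k, l, p, q, fun _ _ => 0, h1, h2, h1', h2', h3, h3', by simpa using h4,
      by simpa using h4', ⟨fun _ _ _ _ _ => rfl, fun _ _ _ _ _ => rfl⟩, ?_, ?_⟩
    · intro _ _
      rw [abs_zero]
      positivity
    · simp [energy]
  | succ T ih =>
    push_cast at hT ⊢
    obtain ⟨K, hLK, hK⟩ := ih (lt_of_le_of_lt (by gcongr; linarith) hT)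
    have hKN : K ≤ (K + 1) * 2 ^ (K + 1) * r := by
      calc K ≤ (K + 1) * 1 * 1 := by omega
        _ ≤ _ := by gcongr; exacts [Nat.one_le_two_pow, by omega]
    refine ⟨2 * ((K + 1) * 2 ^ (K + 1) * r), by omega, fun m n hm hn A hA => ?_⟩
    rcases hK m n (by omega) (by omega) A hA with h | h
    · obtain ⟨k, l, p, q, h1, h2, h3, h4, h5⟩ := h
      exact Or.inl ⟨k, l, p, q, h1, by omega, h3, by omega, h5⟩
    · have : Nonempty (Fin m) := ⟨⟨0, by omega⟩⟩
      have : Nonempty (Fin n) := ⟨⟨0, by omega⟩⟩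
      have hadd : ((T : ℝ) + 1) / r + 1 / r = (T + 1 + 1) / r := by ring
      have hle : ((T : ℝ) + 1 + 1) / r ≤ (T + 1 + 2) / r := by gcongr; norm_num
      have hle' : ((T : ℝ) + 1) / r ≤ (T + 1 + 2) / r := by
        gcongr ?_ / _
        linarith
      rcases h.regular_or_increment (r := r) (by simpa using hA) hL hε (by linarith) hr
        (by linarith) (by linarith) (by rw [Fintype.card_fin]; omega)
        (by rw [Fintype.card_fin]; omega) with h | h
      · obtain ⟨k, l, p, q, h1, h2, h3, h4, h5⟩ := h
        exact Or.inl ⟨k, l, p, q, h1, by omega, h3, by omega, h5⟩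
      · right
        rw [hadd] at h
        convert h using 1
        simp only [Fintype.card_fin]
        ring

/-- **Szemerédi's Regularity Lemma for matrices.**  For every `ε > 0` and every positive
integer `L` there is a positive integer `M ≥ L` such that for all `m, n ≥ M`, every nonzero
real `m × n` matrix `A` has an `(ε)`-regular block partition `(𝒫,𝒬)` with exceptional sets
and `L ≤ |𝒫| ≤ M`, `L ≤ |𝒬| ≤ M`. -/
theorem sparse_regularity_for_matrices (ε : ℝ) (hε : 0 < ε) (L : ℕ) (hL : 0 < L) :
    ∃ M : ℕ, 0 < M ∧ L ≤ M ∧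
      ∀ m n : ℕ, M ≤ m → M ≤ n → ∀ A : Fin m → Fin n → ℝ, A ≠ 0 →
        ∃ (k l : ℕ) (p : Fin m → Fin (k + 1)) (q : Fin n → Fin (l + 1)),
          L ≤ k ∧ k ≤ M ∧ L ≤ l ∧ l ≤ M ∧
          ScaledEpsRegularPartition A ε p q := by
  obtain ⟨ε₀, hε₀, hε₀2, hε₀ε⟩ : ∃ ε₀ : ℝ, 0 < ε₀ ∧ ε₀ ≤ 1 / 2 ∧ ε₀ ≤ ε :=
    ⟨min ε (1 / 2), lt_min hε (by norm_num), min_le_right _ _, min_le_left _ _⟩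
  obtain ⟨T, hT⟩ := exists_nat_gt (2 * (16 / ε₀) / (ε₀ ^ 5 / 8))
  obtain ⟨r, hr⟩ := exists_nat_gt (((T : ℝ) + 2) / ε₀)
  have hr2 : (T : ℝ) + 2 < r * ε₀ := (div_lt_iff₀ hε₀).1 hr
  have hr0 : 2 ≤ r := by
    have h1 : (2 : ℝ) ≤ r := by nlinarith [(Nat.cast_nonneg T : (0 : ℝ) ≤ T)]
    exact_mod_cast h1
  have hTr : ((T : ℝ) + 2) / r < ε₀ := by
    rw [div_lt_iff₀ (by positivity)]
    linarith
  obtain ⟨K, hLK, hK⟩ := exists_regular_or_hasEnergyPartition hε₀ hε₀2 hL hr0 T hTr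
  refine ⟨K, by omega, hLK, fun m n hm hn A _ => ?_⟩
  have hnorm : matNorm (normalizeMat A) ≤ m * n := by simpa using matNorm_normalizeMat_le A
  rcases hK m n hm hn _ hnorm with h | h
  · obtain ⟨k, l, p, q, h1, h2, h3, h4, h5⟩ := h
    exact ⟨k, l, p, q, h1, h2, h3, h4, h5.mono hε₀ε⟩
  · obtain ⟨k, l, p, q, c, -, -, -, -, -, -, -, -, -, hcD, hcE⟩ := h
    have hm0 : (0 : ℝ) < m := by exact_mod_cast (by omega : 0 < m)
    have hn0 : (0 : ℝ) < n := by exact_mod_cast (by omega : 0 < n)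
    have h1 : T * (ε₀ ^ 5 / 8 * (m * n)) ≤ 2 * (16 / ε₀) * (m * n) :=
      hcE.trans ((energy_le hcD).trans (by gcongr))
    have h2 : 2 * (16 / ε₀) < T * (ε₀ ^ 5 / 8) := (div_lt_iff₀ (by positivity)).1 hT
    have h3 : 2 * (16 / ε₀) * (m * n) < T * (ε₀ ^ 5 / 8) * (m * n : ℝ) := by gcongr
    linarith
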